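/- arXiv:1005.4463 — 2 statements merged into one kernel-verified Lean document; each statement's English description precedes it below -/
import Mathlib

section
/- Let $2 < r < 3$ and let $\phi, f, g \in C_0^\infty(\mathbb{R}^3)$. Then $\left| \int_{\mathbb{R}^3} \phi\, f\, g \; dx \right| \leq C \|\phi\|_{L^2}^{(r-1)/r} \|\partial_{x_1}\phi\|_{L^{2/(3-r)}}^{1/r} \|f\|_{L^2}^{(r-2)/r} \|\partial_{x_2} f\|_{L^2}^{1/r} \|\partial_{x_3} f\|_{L^2}^{1/r} \|g\|_{L^2}$, where $C$ is a constant depending only on $r$. -/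
open MeasureTheory Real ENNReal

/-- Partial derivative in the `i`-th coordinate direction on `ℝ × ℝ × ℝ`. -/
noncomputable def pd (i : Fin 3) (φ : ℝ × ℝ × ℝ → ℝ) : ℝ × ℝ × ℝ → ℝ :=
  fun x => fderiv ℝ φ x (![((1:ℝ), (0:ℝ), (0:ℝ)), (0, 1, 0), (0, 0, 1)] i)

lemma oneD {u : ℝ → ℝ} (hu : ContDiff ℝ 1 u) (hc : HasCompactSupport u) {p : ℝ} (hp : 1 < p)
    (x : ℝ) : ‖u x‖ₑ ^ p ≤ ENNReal.ofReal p * ∫⁻ y, ‖u y‖ₑ ^ (p - 1) * ‖deriv u y‖ₑ := by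
  have hp0 : 0 < p := by linarith
  have h1 : ContDiff ℝ 1 (fun x => ‖u x‖ ^ p) := hu.norm_rpow hp
  have h2 : HasCompactSupport (fun x => ‖u x‖ ^ p) :=
    hc.comp_left (g := fun y : ℝ => ‖y‖ ^ p) (by simp [hp0.ne'])
  have h3 := h2.enorm_le_lintegral_Ici_deriv h1 x
  have h4 : ‖‖u x‖ ^ p‖ₑ = ‖u x‖ₑ ^ p := by
    rw [Real.enorm_eq_ofReal (by positivity), ← ENNReal.ofReal_rpow_of_nonneg (norm_nonneg _) hp0.le,
      ofReal_norm]
  rw [h4] at h3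
  refine h3.trans ((setLIntegral_le_lintegral _ _).trans ?_)
  rw [← lintegral_const_mul' _ _ ENNReal.ofReal_ne_top]
  refine lintegral_mono fun y => ?_
  have h5 := enorm_fderiv_norm_rpow_le (hu.differentiable one_ne_zero) (x := y)
    (p := ⟨p, hp0.le⟩) (by exact_mod_cast hp)
  have e1 : ‖deriv (fun x => ‖u x‖ ^ p) y‖ₑ = ‖fderiv ℝ (fun x => ‖u x‖ ^ p) y‖ₑ := by
    rw [← ofReal_norm, ← ofReal_norm, norm_deriv_eq_norm_fderiv]
  have e2 : ‖deriv u y‖ₑ = ‖fderiv ℝ u y‖ₑ := by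
    rw [← ofReal_norm, ← ofReal_norm, norm_deriv_eq_norm_fderiv]
  rw [e1, e2, ← mul_assoc]
  refine h5.trans (le_of_eq ?_)
  congr 2
  rw [ENNReal.ofReal, Real.toNNReal_of_nonneg hp0.le]
  rfl

lemma paramInt {h h' : ℝ × ℝ → ℝ} (hh : Continuous h) (hh' : Continuous h')
    (hc : HasCompactSupport h) (hc' : HasCompactSupport h')
    (hd : ∀ x t, HasDerivAt (fun t => h (x, t)) (h' (x, t)) t) :
    ContDiff ℝ 1 (fun t => ∫ x, h (x, t)) ∧ HasCompactSupport (fun t => ∫ x, h (x, t)) ∧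
    ∀ t, deriv (fun t => ∫ x, h (x, t)) t = ∫ x, h' (x, t) := by
  obtain ⟨M, hM⟩ := hc'.exists_bound_of_continuous hh'
  set K : Set ℝ := Prod.fst '' tsupport h' with hK
  have hKc : IsCompact K := hc'.isCompact.image continuous_fst
  have hbd : ∀ x t, ‖h' (x, t)‖ ≤ K.indicator (fun _ => M) x := by
    intro x t
    by_cases hx : x ∈ K
    · simpa [hx] using hM (x, t)
    · have : h' (x, t) = 0 := by
        by_contra h0
        exact hx ⟨(x, t), subset_tsupport _ h0, rfl⟩
      simp [hx, this]
  have hbi : Integrable (K.indicator (fun _ => M)) (volume : Measure ℝ) := by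
    rw [integrable_indicator_iff hKc.measurableSet]
    exact integrableOn_const hKc.measure_lt_top.ne
  have hder : ∀ t, HasDerivAt (fun t => ∫ x, h (x, t)) (∫ x, h' (x, t)) t := by
    intro t
    refine (hasDerivAt_integral_of_dominated_loc_of_deriv_le (F := fun t x => h (x, t))
      (F' := fun t x => h' (x, t)) (s := Set.univ) (bound := K.indicator (fun _ => M))
      Filter.univ_mem ?_ ?_ ?_ ?_ hbi ?_).2
    · exact Filter.Eventually.of_forall fun t =>
        (hh.comp (by fun_prop : Continuous fun x : ℝ => (x, t))).aestronglyMeasurable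
    · refine Continuous.integrable_of_hasCompactSupport (hh.comp (by fun_prop : Continuous fun x : ℝ => (x, t))) ?_
      refine HasCompactSupport.intro (hc.isCompact.image continuous_fst) fun x hx => ?_
      by_contra h0
      exact hx ⟨(x, t), subset_tsupport _ h0, rfl⟩
    · exact (hh'.comp (by fun_prop : Continuous fun x : ℝ => (x, t))).aestronglyMeasurable
    · exact Filter.Eventually.of_forall fun x t _ => hbd x t
    · exact Filter.Eventually.of_forall fun x t _ => hd x t
  refine ⟨?_, ?_, fun t => (hder t).deriv⟩
  · rw [contDiff_one_iff_deriv]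
    refine ⟨fun t => (hder t).differentiableAt, ?_⟩
    rw [show deriv (fun t => ∫ x, h (x, t)) = fun t => ∫ x, h' (x, t) from
      funext fun t => (hder t).deriv]
    refine continuous_of_dominated (bound := K.indicator (fun _ => M)) (fun t => ?_) (fun t => ?_) hbi ?_
    · exact (hh'.comp (by fun_prop : Continuous fun x : ℝ => (x, t))).aestronglyMeasurable
    · exact Filter.Eventually.of_forall fun x => hbd x t
    · exact Filter.Eventually.of_forall fun x => hh'.comp (by fun_prop : Continuous fun t : ℝ => (x, t))
  · refine HasCompactSupport.intro (hc.isCompact.image continuous_snd) fun t ht => ?_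
    have : ∀ x, h (x, t) = 0 := fun x => by
      by_contra h0
      exact ht ⟨(x, t), subset_tsupport _ h0, rfl⟩
    simp [this]

lemma slab {k k' : ℝ × ℝ → ℝ} (hh : Continuous k) (hh' : Continuous k')
    (hc : HasCompactSupport k)
    (hd : ∀ x t, HasDerivAt (fun t => k (x, t)) (k' (x, t)) t) {p : ℝ} (hp : 1 < p) (t : ℝ) :
    (∫⁻ x, ‖k (x, t)‖ₑ ^ (2:ℝ)) ^ p ≤ ENNReal.ofReal (2 * p) *
      ∫⁻ τ, (∫⁻ x, ‖k (x, τ)‖ₑ ^ (2:ℝ)) ^ (p - 1 / 2) *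
        (∫⁻ x, ‖k' (x, τ)‖ₑ ^ (2:ℝ)) ^ (1 / 2 : ℝ) := by
  have hp0 : 0 < p := by linarith
  obtain ⟨h1, h2, h3⟩ := paramInt (h := fun z => k z ^ 2) (h' := fun z => 2 * k z * k' z)
    (by fun_prop) (by fun_prop) (hc.comp_left (g := fun y : ℝ => y ^ 2) (by simp))
    ((hc.mul_left (f := fun _ => (2:ℝ))).mul_right)
    (fun x t => by have := (hd x t).fun_pow 2; norm_num at this; exact this)
  have hslice : ∀ t, Integrable (fun x => k (x, t) ^ 2) := fun t => by
    refine Continuous.integrable_of_hasCompactSupport (by fun_prop) ?_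
    refine HasCompactSupport.intro (hc.isCompact.image continuous_fst) fun x hx => ?_
    by_contra h0
    exact hx ⟨(x, t), subset_tsupport _ (by simpa using h0), rfl⟩
  have hF : ∀ t, ‖∫ x, k (x, t) ^ 2‖ₑ = ∫⁻ x, ‖k (x, t)‖ₑ ^ (2:ℝ) := fun t => by
    rw [Real.enorm_eq_ofReal (integral_nonneg fun x => by positivity),
      ofReal_integral_eq_lintegral_ofReal (hslice t) (Filter.Eventually.of_forall fun x => by positivity)]
    refine lintegral_congr fun x => ?_
    rw [← ofReal_norm, ENNReal.ofReal_rpow_of_nonneg (norm_nonneg _) (by norm_num)]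
    simp
  have := oneD h1 h2 hp t
  simp only [hF, h3] at this
  refine this.trans ?_
  rw [mul_comm 2 p, ENNReal.ofReal_mul hp0.le, mul_assoc]
  gcongr
  rw [← lintegral_const_mul' _ _ ENNReal.ofReal_ne_top]
  refine lintegral_mono fun τ => ?_
  have hcs : ‖∫ x, 2 * k (x, τ) * k' (x, τ)‖ₑ ≤ ENNReal.ofReal 2 *
      ((∫⁻ x, ‖k (x, τ)‖ₑ ^ (2:ℝ)) ^ (1 / 2 : ℝ) * (∫⁻ x, ‖k' (x, τ)‖ₑ ^ (2:ℝ)) ^ (1 / 2 : ℝ)) := by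
    refine (enorm_integral_le_lintegral_enorm _).trans ?_
    have hcs := ENNReal.lintegral_mul_norm_pow_le (μ := (volume : Measure ℝ))
      (f := fun x => ‖k (x, τ)‖ₑ ^ (2:ℝ)) (g := fun x => ‖k' (x, τ)‖ₑ ^ (2:ℝ))
      (by fun_prop) (by fun_prop) (p := 1 / 2) (q := 1 / 2) (by norm_num) (by norm_num) (by norm_num)
    refine le_trans (le_of_eq ?_) (mul_le_mul_right hcs _)
    rw [← lintegral_const_mul' _ _ ENNReal.ofReal_ne_top]
    refine lintegral_congr fun x => ?_
    rw [← ENNReal.rpow_mul, ← ENNReal.rpow_mul]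
    norm_num [enorm_mul, mul_assoc]
    simp [Real.enorm_eq_ofReal]
  refine (mul_le_mul_right hcs _).trans_eq ?_
  rw [show p - 1 / 2 = (p - 1) + 1 / 2 by ring,
    ENNReal.rpow_add_of_nonneg _ _ (by linarith) (by norm_num)]
  ring

lemma absorb {X Y K : ℝ≥0∞} {s : ℝ} (hs : 2 < s) (hX : X ≠ ⊤)
    (h : X ≤ K * (Y ^ (1 / (s - 1)) * X ^ ((s - 2) / (s - 1)))) : X ≤ K ^ (s - 1) * Y := by
  by_cases h0 : X = 0
  · simp [h0]
  have hs1 : 0 < s - 1 := by linarith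
  have e : X = X ^ (1 / (s - 1)) * X ^ ((s - 2) / (s - 1)) := by
    rw [← ENNReal.rpow_add _ _ h0 hX, ← add_div, show 1 + (s - 2) = s - 1 by ring,
      div_self hs1.ne', ENNReal.rpow_one]
  have hb0 : X ^ ((s - 2) / (s - 1)) ≠ 0 := by
    simp [ENNReal.rpow_eq_zero_iff, h0, hX]
  have hbt : X ^ ((s - 2) / (s - 1)) ≠ ⊤ := by
    simp [ENNReal.rpow_eq_top_iff, h0, hX]
  have h1 : X ^ (1 / (s - 1)) ≤ K * Y ^ (1 / (s - 1)) := by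
    rw [← mul_assoc] at h
    nth_rewrite 1 [e] at h
    exact (ENNReal.mul_le_mul_iff_left hb0 hbt).1 h
  have h2 := ENNReal.rpow_le_rpow h1 hs1.le
  rw [ENNReal.mul_rpow_of_nonneg _ _ hs1.le, ← ENNReal.rpow_mul, ← ENNReal.rpow_mul,
    one_div_mul_cancel hs1.ne', ENNReal.rpow_one, ENNReal.rpow_one] at h2
  exact h2

lemma twoD {F G H : ℝ × ℝ → ℝ≥0∞} (hF : Measurable F) (hG : Measurable G) (hH : Measurable H)
    {p : ℝ} (hp : 1 < p) {c : ℝ≥0∞} (hc : c ≠ ⊤)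
    (h1 : ∀ a b, F (a, b) ^ p ≤ c * ∫⁻ τ, F (τ, b) ^ (p - 1 / 2) * G (τ, b) ^ (1 / 2 : ℝ))
    (h2 : ∀ a b, F (a, b) ^ p ≤ c * ∫⁻ τ, F (a, τ) ^ (p - 1 / 2) * H (a, τ) ^ (1 / 2 : ℝ))
    (hfin : ∫⁻ y, F y ^ (2 * p) ≠ ⊤) :
    ∫⁻ y, F y ^ (2 * p) ≤
      (c ^ 2 * ((∫⁻ y, G y) ^ (1 / 2 : ℝ) * (∫⁻ y, H y) ^ (1 / 2 : ℝ))) ^ (2 * p - 1) * ∫⁻ y, F y := by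
  have hs1 : 0 < 2 * p - 1 := by linarith
  refine absorb (by linarith) hfin ?_
  have cs : ∀ G : ℝ × ℝ → ℝ≥0∞, Measurable G → ∫⁻ y, F y ^ (p - 1 / 2) * G y ^ (1 / 2 : ℝ) ≤
      (∫⁻ y, F y ^ (2 * p - 1)) ^ (1 / 2 : ℝ) * (∫⁻ y, G y) ^ (1 / 2 : ℝ) := by
    intro G hG
    refine le_trans (le_of_eq ?_) (ENNReal.lintegral_mul_norm_pow_le
      (f := fun y => F y ^ (2 * p - 1)) (g := G)
      (by fun_prop) (by fun_prop) (p := 1 / 2) (q := 1 / 2) (by norm_num) (by norm_num) (by norm_num))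
    refine lintegral_congr fun y => ?_
    rw [← ENNReal.rpow_mul]
    congr 2; ring
  have interp : ∫⁻ y, F y ^ (2 * p - 1) ≤ (∫⁻ y, F y) ^ (1 / (2 * p - 1)) *
      (∫⁻ y, F y ^ (2 * p)) ^ ((2 * p - 2) / (2 * p - 1)) := by
    refine le_trans (le_of_eq ?_) (ENNReal.lintegral_mul_norm_pow_le
      (f := F) (g := fun y => F y ^ (2 * p))
      (by fun_prop) (by fun_prop) (p := 1 / (2 * p - 1)) (q := (2 * p - 2) / (2 * p - 1))
      (by positivity) (div_nonneg (by linarith) hs1.le) (by field_simp; ring))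
    refine lintegral_congr fun y => ?_
    rw [← ENNReal.rpow_mul, ← ENNReal.rpow_add_of_nonneg _ _ (by positivity)
      (mul_nonneg (by linarith) (div_nonneg (by linarith) hs1.le))]
    congr 1; field_simp; ring
  set A : ℝ → ℝ≥0∞ := fun b => ∫⁻ τ, F (τ, b) ^ (p - 1 / 2) * G (τ, b) ^ (1 / 2 : ℝ) with hA
  set B : ℝ → ℝ≥0∞ := fun a => ∫⁻ τ, F (a, τ) ^ (p - 1 / 2) * H (a, τ) ^ (1 / 2 : ℝ) with hB
  have mG : Measurable fun y => F y ^ (p - 1 / 2) * G y ^ (1 / 2 : ℝ) := by fun_prop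
  have mH : Measurable fun y => F y ^ (p - 1 / 2) * H y ^ (1 / 2 : ℝ) := by fun_prop
  have mA : Measurable A := mG.lintegral_prod_left'
  have mB : Measurable B := mH.lintegral_prod_right'
  have iA : ∫⁻ b, A b = ∫⁻ y, F y ^ (p - 1 / 2) * G y ^ (1 / 2 : ℝ) := by
    rw [Measure.volume_eq_prod, lintegral_prod_symm' _ mG]
  have iB : ∫⁻ a, B a = ∫⁻ y, F y ^ (p - 1 / 2) * H y ^ (1 / 2 : ℝ) := by
    rw [Measure.volume_eq_prod, lintegral_prod _ mH.aemeasurable]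
  calc ∫⁻ y, F y ^ (2 * p) ≤ ∫⁻ y : ℝ × ℝ, c ^ 2 * (B y.1 * A y.2) := by
        refine lintegral_mono fun ⟨a, b⟩ => ?_
        dsimp only
        rw [two_mul, ENNReal.rpow_add_of_nonneg _ _ (by linarith) (by linarith)]
        refine (mul_le_mul' (h2 a b) (h1 a b)).trans_eq ?_
        simp only [hA, hB]; ring
    _ = c ^ 2 * ((∫⁻ a, B a) * ∫⁻ b, A b) := by
        rw [lintegral_const_mul' _ _ (by simp [hc]), Measure.volume_eq_prod,
          lintegral_prod_mul mB.aemeasurable mA.aemeasurable]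
    _ ≤ c ^ 2 * (((∫⁻ y, F y ^ (2 * p - 1)) ^ (1 / 2 : ℝ) * (∫⁻ y, H y) ^ (1 / 2 : ℝ)) *
          ((∫⁻ y, F y ^ (2 * p - 1)) ^ (1 / 2 : ℝ) * (∫⁻ y, G y) ^ (1 / 2 : ℝ))) := by
        rw [iA, iB]
        gcongr
        · exact cs H hH
        · exact cs G hG
    _ = c ^ 2 * ((∫⁻ y, G y) ^ (1 / 2 : ℝ) * (∫⁻ y, H y) ^ (1 / 2 : ℝ)) *
          ∫⁻ y, F y ^ (2 * p - 1) := by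
        have : ∫⁻ y, F y ^ (2 * p - 1) = (∫⁻ y, F y ^ (2 * p - 1)) ^ (1 / 2 : ℝ) *
            (∫⁻ y, F y ^ (2 * p - 1)) ^ (1 / 2 : ℝ) := by
          rw [← ENNReal.rpow_add_of_nonneg _ _ (by norm_num) (by norm_num)]; norm_num
        conv_rhs => rw [this]
        ring
    _ ≤ _ := by gcongr

lemma pd_cont {f : ℝ × ℝ × ℝ → ℝ} (hf : ContDiff ℝ (⊤ : ℕ∞) f) (i : Fin 3) :
    Continuous (pd i f) :=
  (hf.continuous_fderiv (by simp)).clm_apply continuous_const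

lemma pd_deriv0 {f : ℝ × ℝ × ℝ → ℝ} (hf : ContDiff ℝ (⊤ : ℕ∞) f) (a b c : ℝ) :
    HasDerivAt (fun t => f (t, b, c)) (pd 0 f (a, b, c)) a := by
  have h := ((hf.differentiable (by simp)) (a, b, c)).hasFDerivAt
  have h2 : HasDerivAt (fun t : ℝ => (t, b, c)) ((1:ℝ), (0:ℝ), (0:ℝ)) a :=
    (hasDerivAt_id a).prodMk (hasDerivAt_const a (b, c))
  exact h.comp_hasDerivAt a h2

lemma pd_deriv1 {f : ℝ × ℝ × ℝ → ℝ} (hf : ContDiff ℝ (⊤ : ℕ∞) f) (a b c : ℝ) :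
    HasDerivAt (fun t => f (a, t, c)) (pd 1 f (a, b, c)) b := by
  have h := ((hf.differentiable (by simp)) (a, b, c)).hasFDerivAt
  have h2 : HasDerivAt (fun t : ℝ => (a, t, c)) ((0:ℝ), (1:ℝ), (0:ℝ)) b :=
    (hasDerivAt_const b a).prodMk ((hasDerivAt_id b).prodMk (hasDerivAt_const b c))
  exact h.comp_hasDerivAt b h2

lemma pd_deriv2 {f : ℝ × ℝ × ℝ → ℝ} (hf : ContDiff ℝ (⊤ : ℕ∞) f) (a b c : ℝ) :
    HasDerivAt (fun t => f (a, b, t)) (pd 2 f (a, b, c)) c := by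
  have h := ((hf.differentiable (by simp)) (a, b, c)).hasFDerivAt
  have h2 : HasDerivAt (fun t : ℝ => (a, b, t)) ((0:ℝ), (0:ℝ), (1:ℝ)) c :=
    (hasDerivAt_const c a).prodMk ((hasDerivAt_const c b).prodMk (hasDerivAt_id c))
  exact h.comp_hasDerivAt c h2

lemma eL2 (f : ℝ × ℝ × ℝ → ℝ) : eLpNorm f 2 volume = (∫⁻ x, ‖f x‖ₑ ^ (2:ℝ)) ^ (1 / 2 : ℝ) := by
  rw [eLpNorm_eq_lintegral_rpow_enorm_toReal (by norm_num) (by norm_num)]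
  simp

lemma fub {h : ℝ × ℝ × ℝ → ℝ≥0∞} (hh : Measurable h) :
    ∫⁻ y : ℝ × ℝ, ∫⁻ x, h (x, y) = ∫⁻ z, h z := by
  rw [Measure.volume_eq_prod ℝ (ℝ × ℝ), lintegral_prod_symm' _ hh]

lemma partF {f : ℝ × ℝ × ℝ → ℝ} (hf : ContDiff ℝ (⊤ : ℕ∞) f) (hc : HasCompactSupport f)
    {p : ℝ} (hp : 1 < p) :
    ∫⁻ y : ℝ × ℝ, (∫⁻ x, ‖f (x, y)‖ₑ ^ (2:ℝ)) ^ (2 * p) ≤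
      (ENNReal.ofReal (2 * p) ^ 2 * (eLpNorm (pd 1 f) 2 volume * eLpNorm (pd 2 f) 2 volume))
        ^ (2 * p - 1) * eLpNorm f 2 volume ^ (2:ℝ) := by
  have hfc := hf.continuous
  have h1c := pd_cont hf 1
  have h2c := pd_cont hf 2
  have mF : Measurable fun z : ℝ × ℝ × ℝ => ‖f z‖ₑ ^ (2:ℝ) := by fun_prop
  have m1 : Measurable fun z : ℝ × ℝ × ℝ => ‖pd 1 f z‖ₑ ^ (2:ℝ) := by fun_prop
  have m2 : Measurable fun z : ℝ × ℝ × ℝ => ‖pd 2 f z‖ₑ ^ (2:ℝ) := by fun_prop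
  have key := twoD (F := fun y => ∫⁻ x, ‖f (x, y)‖ₑ ^ (2:ℝ))
    (G := fun y => ∫⁻ x, ‖pd 1 f (x, y)‖ₑ ^ (2:ℝ)) (H := fun y => ∫⁻ x, ‖pd 2 f (x, y)‖ₑ ^ (2:ℝ))
    mF.lintegral_prod_left' m1.lintegral_prod_left' m2.lintegral_prod_left' hp
    (c := ENNReal.ofReal (2 * p)) ENNReal.ofReal_ne_top ?_ ?_ ?_
  · rw [fub mF, fub m1, fub m2] at key
    rw [eL2, eL2, eL2, ← ENNReal.rpow_mul]
    norm_num at key ⊢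
    exact key
  · intro a b
    refine slab (k := fun z => f (z.1, z.2, b)) (k' := fun z => pd 1 f (z.1, z.2, b))
      (by fun_prop) (by fun_prop) ?_ (fun x t => pd_deriv1 hf x t b) hp a
    refine HasCompactSupport.intro (hc.isCompact.image
      (by fun_prop : Continuous fun z : ℝ × ℝ × ℝ => (z.1, z.2.1))) fun x hx => ?_
    by_contra h0
    exact hx ⟨(x.1, x.2, b), subset_tsupport _ h0, rfl⟩
  · intro a b
    refine slab (k := fun z => f (z.1, a, z.2)) (k' := fun z => pd 2 f (z.1, a, z.2))
      (by fun_prop) (by fun_prop) ?_ (fun x t => pd_deriv2 hf x a t) hp b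
    refine HasCompactSupport.intro (hc.isCompact.image
      (by fun_prop : Continuous fun z : ℝ × ℝ × ℝ => (z.1, z.2.2))) fun x hx => ?_
    by_contra h0
    exact hx ⟨(x.1, a, x.2), subset_tsupport _ h0, rfl⟩
  · obtain ⟨M, hM⟩ := hc.exists_bound_of_continuous hfc
    have hK1 : IsCompact (Prod.fst '' tsupport f) := hc.isCompact.image continuous_fst
    have hK2 : IsCompact (Prod.snd '' tsupport f) := hc.isCompact.image continuous_snd
    set K1 := Prod.fst '' tsupport f
    set K2 := Prod.snd '' tsupport f
    set D : ℝ≥0∞ := ENNReal.ofReal M ^ (2:ℝ) * volume K1 with hD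
    have hDt : D ≠ ⊤ := ENNReal.mul_ne_top (by simp) hK1.measure_lt_top.ne
    have hle : ∀ y : ℝ × ℝ, (∫⁻ x, ‖f (x, y)‖ₑ ^ (2:ℝ)) ^ (2 * p) ≤
        K2.indicator (fun _ => D ^ (2 * p)) y := by
      intro y
      by_cases hy : y ∈ K2
      · rw [Set.indicator_of_mem hy]
        refine ENNReal.rpow_le_rpow ?_ (by linarith)
        calc ∫⁻ x, ‖f (x, y)‖ₑ ^ (2:ℝ) ≤ ∫⁻ x, K1.indicator (fun _ => ENNReal.ofReal M ^ (2:ℝ)) x := by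
              refine lintegral_mono fun x => ?_
              by_cases hx : x ∈ K1
              · rw [Set.indicator_of_mem hx]
                refine ENNReal.rpow_le_rpow ?_ (by norm_num)
                rw [← ofReal_norm]
                exact ENNReal.ofReal_le_ofReal (hM _)
              · have : f (x, y) = 0 := by
                  by_contra h0
                  exact hx ⟨(x, y), subset_tsupport _ h0, rfl⟩
                simp [this]
          _ = D := by rw [lintegral_indicator_const hK1.measurableSet]
      · have : ∀ x, f (x, y) = 0 := fun x => by
          by_contra h0
          exact hy ⟨(x, y), subset_tsupport _ h0, rfl⟩
        have hp0 : 0 < p := by linarith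
        simp [this, hp0]
    refine ne_top_of_le_ne_top ?_ (lintegral_mono hle)
    rw [lintegral_indicator_const hK2.measurableSet]
    exact ENNReal.mul_ne_top (ENNReal.rpow_ne_top_of_nonneg (by linarith) hDt) hK2.measure_lt_top.ne

lemma partPhi {φ : ℝ × ℝ × ℝ → ℝ} (hf : ContDiff ℝ (⊤ : ℕ∞) φ) 
    {r : ℝ} (hr2 : 2 < r) (hr3 : r < 3) :
    ∫⁻ z, ‖φ z‖ₑ ^ (r - 1) * ‖pd 0 φ z‖ₑ ≤ eLpNorm φ 2 volume ^ (r - 1) *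
      eLpNorm (pd 0 φ) (ENNReal.ofReal (2 / (3 - r))) volume := by
  have hfc := hf.continuous
  have h1c := pd_cont hf 0
  have h3 : 0 < 3 - r := by linarith
  have hq : 0 < 2 / (3 - r) := by positivity
  have h := ENNReal.lintegral_mul_norm_pow_le (μ := (volume : Measure (ℝ × ℝ × ℝ)))
    (f := fun z => ‖φ z‖ₑ ^ (2:ℝ)) (g := fun z => ‖pd 0 φ z‖ₑ ^ (2 / (3 - r)))
    (by fun_prop) (by fun_prop) (p := (r - 1) / 2) (q := (3 - r) / 2) (by linarith) (by linarith)
    (by ring)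
  rw [eL2, eLpNorm_eq_lintegral_rpow_enorm_toReal (by simpa using hq) (by simp),
    ENNReal.toReal_ofReal hq.le, ← ENNReal.rpow_mul]
  simp only [← ENNReal.rpow_mul] at h
  rw [show 2 * ((r - 1) / 2) = r - 1 by ring,
    show 2 / (3 - r) * ((3 - r) / 2) = 1 by field_simp] at h
  rw [show 1 / 2 * (r - 1) = (r - 1) / 2 by ring, one_div_div]
  simpa using h

lemma mainHolder {φ f g : ℝ × ℝ × ℝ → ℝ} (hφ : ContDiff ℝ (⊤ : ℕ∞) φ) (cφ : HasCompactSupport φ)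
    (hf : ContDiff ℝ (⊤ : ℕ∞) f) (hg : ContDiff ℝ (⊤ : ℕ∞) g)
    {r : ℝ} (hr2 : 2 < r) :
    ∫⁻ z, ‖φ z * f z * g z‖ₑ ≤
      (ENNReal.ofReal r * ∫⁻ z, ‖φ z‖ₑ ^ (r - 1) * ‖pd 0 φ z‖ₑ) ^ (1 / r) *
      (∫⁻ y : ℝ × ℝ, (∫⁻ x, ‖f (x, y)‖ₑ ^ (2:ℝ)) ^ (r / (r - 2))) ^ ((r - 2) / (2 * r)) *
      eLpNorm g 2 volume := by
  have hr0 : 0 < r := by linarith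
  have hr20 : 0 < r - 2 := by linarith
  have c1 := hφ.continuous
  have c2 := hf.continuous
  have c3 := hg.continuous
  have c4 := pd_cont hφ 0
  have mP : Measurable fun z => ‖φ z‖ₑ ^ (r - 1) * ‖pd 0 φ z‖ₑ := by fun_prop
  have mF : Measurable fun z => ‖f z‖ₑ ^ (2:ℝ) := by fun_prop
  have mG : Measurable fun z => ‖g z‖ₑ ^ (2:ℝ) := by fun_prop
  have mA : Measurable fun z => ‖φ z * f z * g z‖ₑ := by fun_prop
  set P : ℝ × ℝ → ℝ≥0∞ := fun y =>
    ENNReal.ofReal r * ∫⁻ x, ‖φ (x, y)‖ₑ ^ (r - 1) * ‖pd 0 φ (x, y)‖ₑ with hP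
  set F : ℝ × ℝ → ℝ≥0∞ := fun y => ∫⁻ x, ‖f (x, y)‖ₑ ^ (2:ℝ) with hF
  set G : ℝ × ℝ → ℝ≥0∞ := fun y => ∫⁻ x, ‖g (x, y)‖ₑ ^ (2:ℝ) with hG
  have mP' : Measurable P := mP.lintegral_prod_left'.const_mul _
  have mF' : Measurable F := mF.lintegral_prod_left'
  have mG' : Measurable G := mG.lintegral_prod_left'
  have hpt : ∀ x y, ‖φ (x, y)‖ₑ ≤ P y ^ (1 / r) := by
    intro x y
    have := oneD (u := fun t => φ (t, y)) ((hφ.of_le (by simp)).comp (by fun_prop))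
      (HasCompactSupport.intro (cφ.isCompact.image continuous_fst) fun x hx => by
        by_contra h0
        exact hx ⟨(x, y), subset_tsupport _ h0, rfl⟩) (p := r) (by linarith) x
    have hd : ∀ t, deriv (fun t => φ (t, y)) t = pd 0 φ (t, y) := fun t =>
      (pd_deriv0 hφ t y.1 y.2).deriv
    simp only [hd] at this
    rw [one_div]
    exact (ENNReal.le_rpow_inv_iff hr0).2 this
  have hin : ∀ y, ∫⁻ x, ‖φ (x, y) * f (x, y) * g (x, y)‖ₑ ≤
      P y ^ (1 / r) * (F y ^ (1 / 2 : ℝ) * G y ^ (1 / 2 : ℝ)) := by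
    intro y
    have hcs := ENNReal.lintegral_mul_norm_pow_le (μ := (volume : Measure ℝ))
      (f := fun x => ‖f (x, y)‖ₑ ^ (2:ℝ)) (g := fun x => ‖g (x, y)‖ₑ ^ (2:ℝ))
      (by fun_prop) (by fun_prop) (p := 1 / 2) (q := 1 / 2) (by norm_num) (by norm_num) (by norm_num)
    refine le_trans ?_ (mul_le_mul_right hcs _)
    rw [← lintegral_const_mul _ (by fun_prop)]
    refine lintegral_mono fun x => ?_
    rw [← ENNReal.rpow_mul, ← ENNReal.rpow_mul, enorm_mul, enorm_mul, mul_assoc]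
    norm_num
    gcongr
    simpa using hpt x y
  rw [← fub mA]
  refine (lintegral_mono hin).trans ?_
  have h3 := ENNReal.lintegral_prod_norm_pow_le (μ := (volume : Measure (ℝ × ℝ))) Finset.univ
    (f := ![P, fun y => F y ^ (r / (r - 2)), G]) (p := ![1 / r, (r - 2) / (2 * r), 1 / 2])
    (by
      intro i _
      fin_cases i
      · exact mP'.aemeasurable
      · exact (mF'.pow_const _).aemeasurable
      · exact mG'.aemeasurable)
    (by simp [Fin.sum_univ_three]; field_simp; ring)
    (by
      intro i _
      fin_cases i
      · simp; positivity
      · simp; positivity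
      · simp)
  simp only [Fin.prod_univ_three, Matrix.cons_val_zero, Matrix.cons_val_one, Matrix.cons_val] at h3
  refine le_trans (le_of_eq ?_) (h3.trans_eq ?_)
  · refine lintegral_congr fun y => ?_
    rw [← ENNReal.rpow_mul, mul_assoc]
    congr 4
    field_simp
  · rw [eL2, ← fub mG, ← fub mP, lintegral_const_mul' _ _ ENNReal.ofReal_ne_top]

theorem stmt0 (r : ℝ) (hr2 : 2 < r) (hr3 : r < 3) :
    ∃ C : ℝ≥0∞, C ≠ ⊤ ∧ ∀ φ f g : ℝ × ℝ × ℝ → ℝ,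
      ContDiff ℝ (⊤ : ℕ∞) φ → HasCompactSupport φ →
      ContDiff ℝ (⊤ : ℕ∞) f → HasCompactSupport f →
      ContDiff ℝ (⊤ : ℕ∞) g → HasCompactSupport g →
      ENNReal.ofReal |∫ x, φ x * f x * g x| ≤
        C * eLpNorm φ 2 volume ^ ((r - 1) / r)
          * eLpNorm (pd 0 φ) (ENNReal.ofReal (2 / (3 - r))) volume ^ (1 / r)
          * eLpNorm f 2 volume ^ ((r - 2) / r)
          * eLpNorm (pd 1 f) 2 volume ^ (1 / r)
          * eLpNorm (pd 2 f) 2 volume ^ (1 / r)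
          * eLpNorm g 2 volume := by
  have hr0 : 0 < r := by linarith
  have hr20 : 0 < r - 2 := by linarith
  have hir : 0 ≤ 1 / r := by positivity
  refine ⟨ENNReal.ofReal r ^ (1 / r) * (ENNReal.ofReal (r / (r - 2)) ^ 2) ^ (1 / r),
    ENNReal.mul_ne_top (ENNReal.rpow_ne_top_of_nonneg hir (by simp))
      (ENNReal.rpow_ne_top_of_nonneg hir (by simp)), ?_⟩
  intro φ f g hφ cφ hf cf hg _
  have e : ENNReal.ofReal |∫ x, φ x * f x * g x| = ‖∫ x, φ x * f x * g x‖ₑ := by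
    rw [← ofReal_norm, Real.norm_eq_abs]
  rw [e]
  refine (enorm_integral_le_lintegral_enorm _).trans ((mainHolder hφ cφ hf hg hr2).trans ?_)
  have hF := partF hf cf (p := r / (r - 2) / 2) (by rw [div_div, lt_div_iff₀ (by linarith)]; linarith)
  rw [show 2 * (r / (r - 2) / 2) = r / (r - 2) by ring] at hF
  have hP := partPhi hφ hr2 hr3
  have hk : 0 ≤ (r - 2) / (2 * r) := by positivity
  calc _ ≤ (ENNReal.ofReal r * (eLpNorm φ 2 volume ^ (r - 1) *
      eLpNorm (pd 0 φ) (ENNReal.ofReal (2 / (3 - r))) volume)) ^ (1 / r) *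
      ((ENNReal.ofReal (r / (r - 2)) ^ 2 * (eLpNorm (pd 1 f) 2 volume * eLpNorm (pd 2 f) 2 volume))
        ^ (r / (r - 2) - 1) * eLpNorm f 2 volume ^ (2:ℝ)) ^ ((r - 2) / (2 * r)) *
      eLpNorm g 2 volume := by gcongr
    _ = _ := by
      rw [ENNReal.mul_rpow_of_nonneg _ _ hir, ENNReal.mul_rpow_of_nonneg _ _ hir,
        ENNReal.mul_rpow_of_nonneg _ _ hk, ← ENNReal.rpow_mul, ← ENNReal.rpow_mul,
        ← ENNReal.rpow_mul,
        show (r / (r - 2) - 1) * ((r - 2) / (2 * r)) = 1 / r by field_simp; ring,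
        show 2 * ((r - 2) / (2 * r)) = (r - 2) / r by field_simp,
        show (r - 1) * (1 / r) = (r - 1) / r by ring,
        ENNReal.mul_rpow_of_nonneg _ _ hir, ENNReal.mul_rpow_of_nonneg _ _ hir]
      ring
end

section
/- Let $2 < r < 3$ and let $\phi, f, g \in C_0^\infty(\mathbb{R}^3)$. Then $\left| \int_{\mathbb{R}^3} \phi\, f\, g \; dx \right| \leq C \|\phi\|_{L^2}^{(r-1)/r} \|\partial_{x_3}\phi\|_{L^{2/(3-r)}}^{1/r} \|f\|_{L^2}^{(r-2)/r} \|\partial_{x_1} f\|_{L^2}^{1/r} \|\partial_{x_2} f\|_{L^2}^{1/r} \|g\|_{L^2}$, where $C$ is a constant depending only on $r$. -/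
open MeasureTheory Real ENNReal

lemma aux_one_d (u : ℝ → ℝ) (hu : ContDiff ℝ 1 u) (hc : HasCompactSupport u) (p : ℝ) (hp : 1 < p)
    (t : ℝ) :
    ‖u t‖ₑ ^ p ≤ ENNReal.ofReal p * ∫⁻ s, ‖u s‖ₑ ^ (p - 1) * ‖deriv u s‖ₑ := by
  have hp0 : 0 < p := by linarith
  have h1 : ContDiff ℝ 1 (fun x => ‖u x‖ ^ p) := hu.norm_rpow hp
  have h2 : HasCompactSupport (fun x => ‖u x‖ ^ p) := by
    refine HasCompactSupport.intro hc fun x hx => ?_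
    simp [image_eq_zero_of_notMem_tsupport hx, hp0.ne']
  have h3 := h2.enorm_le_lintegral_Ici_deriv h1 t
  have h4 : ‖‖u t‖ ^ p‖ₑ = ‖u t‖ₑ ^ p := by
    rw [Real.enorm_rpow_of_nonneg (norm_nonneg _) hp0.le, enorm_norm]
  rw [h4] at h3
  refine h3.trans ((setLIntegral_le_lintegral _ _).trans ?_)
  rw [← lintegral_const_mul' _ _ ENNReal.ofReal_ne_top]
  refine lintegral_mono fun s => ?_
  have h5 : HasDerivAt (fun x => |u x| ^ p) (p * |u s| ^ (p - 2) * u s * deriv u s) s :=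
    (hasDerivAt_abs_rpow (u s) hp).comp s ((hu.differentiable one_ne_zero) s).hasDerivAt
  have h6 : deriv (fun x => ‖u x‖ ^ p) s = p * |u s| ^ (p - 2) * u s * deriv u s := by
    simpa using h5.deriv
  simp only [h6]
  rw [enorm_mul, ← mul_assoc]
  gcongr
  rw [← Real.enorm_of_nonneg hp0.le, ← enorm_norm (u s), ← Real.enorm_rpow_of_nonneg (norm_nonneg _) (by linarith),
    ← enorm_mul]
  apply le_of_eq
  rw [← ofReal_norm, ← ofReal_norm]
  congr 1
  rw [norm_mul, norm_mul, norm_mul, mul_assoc]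
  congr 1
  rw [Real.norm_rpow_of_nonneg (abs_nonneg _), Real.norm_rpow_of_nonneg (norm_nonneg _)]
  simp only [Real.norm_eq_abs, abs_abs]
  by_cases h0 : u s = 0
  · simp [h0, show p - 1 ≠ 0 by linarith]
  · rw [← Real.rpow_add_one (abs_ne_zero.2 h0)]
    congr 1; ring

lemma aux_param (h : ℝ × ℝ → ℝ) (hh : ContDiff ℝ 1 h) (hc : HasCompactSupport h) :
    ContDiff ℝ 1 (fun x => ∫ z, h (x, z)) ∧ HasCompactSupport (fun x => ∫ z, h (x, z)) ∧
    ∀ x, deriv (fun x => ∫ z, h (x, z)) x = ∫ z, fderiv ℝ h (x, z) (1, 0) := by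
  have hcd : Continuous (fun v => fderiv ℝ h v (1, 0)) :=
    (hh.continuous_fderiv one_ne_zero).clm_apply continuous_const
  have hcs : HasCompactSupport (fun v => fderiv ℝ h v (1, 0)) := hc.fderiv_apply ℝ _
  obtain ⟨C, hC⟩ := hcs.exists_bound_of_continuous hcd
  have hK : IsCompact (Prod.snd '' tsupport h) := hc.image continuous_snd
  have hK1 : IsCompact (Prod.fst '' tsupport h) := hc.image continuous_fst
  have hz : ∀ x z, z ∉ Prod.snd '' tsupport h → h (x, z) = 0 := fun x z hz =>
    image_eq_zero_of_notMem_tsupport fun hm => hz ⟨_, hm, rfl⟩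
  have hz1 : ∀ x z, x ∉ Prod.fst '' tsupport h → h (x, z) = 0 := fun x z hz =>
    image_eq_zero_of_notMem_tsupport fun hm => hz ⟨_, hm, rfl⟩
  have hdz : ∀ x z, z ∉ Prod.snd '' tsupport h → fderiv ℝ h (x, z) (1, 0) = 0 := fun x z hz => by
    have : (x, z) ∉ tsupport (fderiv ℝ h) := fun hm => hz ⟨_, tsupport_fderiv_subset ℝ hm, rfl⟩
    simp [image_eq_zero_of_notMem_tsupport this]
  have hd : ∀ x, HasDerivAt (fun x => ∫ z, h (x, z)) (∫ z, fderiv ℝ h (x, z) (1, 0)) x := by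
    intro x
    refine (hasDerivAt_integral_of_dominated_loc_of_deriv_le (F := fun x z => h (x, z))
      (F' := fun x z => fderiv ℝ h (x, z) (1, 0)) (s := Set.univ)
      (bound := (Prod.snd '' tsupport h).indicator fun _ => C) Filter.univ_mem ?_ ?_ ?_ ?_ ?_ ?_).2
    · exact Filter.Eventually.of_forall fun x =>
        (hh.continuous.comp (by fun_prop : Continuous fun z : ℝ => (x, z))).aestronglyMeasurable
    · refine Continuous.integrable_of_hasCompactSupport
        (hh.continuous.comp (by fun_prop : Continuous fun z : ℝ => (x, z))) ?_
      exact HasCompactSupport.intro hK fun z hz' => hz x z hz'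
    · exact (hcd.comp (by fun_prop : Continuous fun z : ℝ => (x, z))).aestronglyMeasurable
    · refine Filter.Eventually.of_forall fun z x _ => ?_
      by_cases hm : z ∈ Prod.snd '' tsupport h
      · simp only [hm, Set.indicator_of_mem]; exact hC _
      · simp only [hm, not_false_eq_true, Set.indicator_of_notMem, hdz x z hm, norm_zero, le_refl]
    · rw [integrable_indicator_iff hK.measurableSet]
      exact integrableOn_const hK.measure_lt_top.ne
    · refine Filter.Eventually.of_forall fun z x _ => ?_
      have h1 : HasDerivAt (fun x : ℝ => (x, z)) ((1 : ℝ), (0 : ℝ)) x :=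
        (hasDerivAt_id x).prodMk (hasDerivAt_const x z)
      exact ((hh.differentiable one_ne_zero) (x, z)).hasFDerivAt.comp_hasDerivAt x h1
  refine ⟨?_, ?_, fun x => (hd x).deriv⟩
  · rw [contDiff_one_iff_deriv]
    refine ⟨fun x => (hd x).differentiableAt, ?_⟩
    have : deriv (fun x => ∫ z, h (x, z)) =
        fun x => ∫ z in Prod.snd '' tsupport h, fderiv ℝ h (x, z) (1, 0) := by
      ext x
      rw [(hd x).deriv, setIntegral_eq_integral_of_forall_compl_eq_zero (hdz x)]
    rw [this]
    exact continuous_parametric_integral_of_continuous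
      (f := fun x z => fderiv ℝ h (x, z) (1, 0)) hcd hK
  · refine HasCompactSupport.intro hK1 fun x hx => ?_
    simp [hz1 x _ hx]

lemma aux_key2 (h : ℝ × ℝ → ℝ) (hh : ContDiff ℝ 1 h) (hc : HasCompactSupport h)
    (s : ℝ) (hs : 1 < s) (t : ℝ) :
    (∫⁻ z, ‖h (t, z)‖ₑ ^ (2:ℝ)) ^ s ≤ ENNReal.ofReal (2 * s) *
      ∫⁻ x, (∫⁻ z, ‖h (x, z)‖ₑ ^ (2:ℝ)) ^ (s - 1 / 2) *
        (∫⁻ z, ‖fderiv ℝ h (x, z) (1, 0)‖ₑ ^ (2:ℝ)) ^ (1 / 2 : ℝ) := by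
  have hh2 : ContDiff ℝ 1 (fun v => h v ^ 2) := hh.pow 2
  have hc2 : HasCompactSupport (fun v => h v ^ 2) :=
    HasCompactSupport.intro hc fun v hv => by simp [image_eq_zero_of_notMem_tsupport hv]
  have hcd : Continuous (fun v => fderiv ℝ h v (1, 0)) :=
    (hh.continuous_fderiv one_ne_zero).clm_apply continuous_const
  obtain ⟨h1, h2, h3⟩ := aux_param _ hh2 hc2
  have hA : ∀ x, ‖∫ z, h (x, z) ^ 2‖ₑ = ∫⁻ z, ‖h (x, z)‖ₑ ^ (2:ℝ) := by
    intro x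
    rw [Real.enorm_of_nonneg (integral_nonneg fun z => sq_nonneg _),
      ofReal_integral_eq_lintegral_ofReal]
    · refine lintegral_congr fun z => ?_
      rw [← Real.enorm_of_nonneg (sq_nonneg _), enorm_pow]
      norm_cast
    · refine Continuous.integrable_of_hasCompactSupport
        (hh2.continuous.comp (by fun_prop : Continuous fun z : ℝ => (x, z))) ?_
      exact HasCompactSupport.intro (hc2.image continuous_snd) fun z hz =>
        image_eq_zero_of_notMem_tsupport (f := fun v => h v ^ 2) fun hm => hz ⟨_, hm, rfl⟩
    · exact Filter.Eventually.of_forall fun z => sq_nonneg _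
  have key := aux_one_d _ h1 h2 s hs t
  simp only [hA, h3] at key
  refine key.trans ?_
  rw [mul_comm 2 s, ENNReal.ofReal_mul (by linarith), mul_assoc]
  gcongr
  rw [← lintegral_const_mul' _ _ ENNReal.ofReal_ne_top]
  refine lintegral_mono fun x => ?_
  have hD : ‖∫ z, fderiv ℝ (fun v => h v ^ 2) (x, z) (1, 0)‖ₑ ≤ ENNReal.ofReal 2 *
      ((∫⁻ z, ‖h (x, z)‖ₑ ^ (2:ℝ)) ^ (1 / 2 : ℝ) *
        (∫⁻ z, ‖fderiv ℝ h (x, z) (1, 0)‖ₑ ^ (2:ℝ)) ^ (1 / 2 : ℝ)) := by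
    refine (enorm_integral_le_lintegral_enorm _).trans ?_
    have e1 : ∀ z, ‖fderiv ℝ (fun v => h v ^ 2) (x, z) (1, 0)‖ₑ = ENNReal.ofReal 2 *
        ((‖h (x, z)‖ₑ ^ (2:ℝ)) ^ (1 / 2 : ℝ) *
          (‖fderiv ℝ h (x, z) (1, 0)‖ₑ ^ (2:ℝ)) ^ (1 / 2 : ℝ)) := by
      intro z
      rw [fderiv_fun_pow _ ((hh.differentiable one_ne_zero) (x, z))]
      rw [← ENNReal.rpow_mul, ← ENNReal.rpow_mul]
      norm_num [enorm_mul, mul_assoc]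
      congr 1
      rw [Real.enorm_of_nonneg (by norm_num)]; simp
    simp only [e1]
    rw [lintegral_const_mul' _ _ ENNReal.ofReal_ne_top]
    gcongr
    refine ENNReal.lintegral_mul_norm_pow_le ?_ ?_ (by norm_num) (by norm_num) (by norm_num)
    · exact ((hh.continuous.comp (by fun_prop : Continuous fun z : ℝ => (x, z))).measurable.enorm.pow_const _).aemeasurable
    · exact ((hcd.comp (by fun_prop : Continuous fun z : ℝ => (x, z))).measurable.enorm.pow_const _).aemeasurable
  refine (mul_le_mul_right hD _).trans (le_of_eq ?_)
  rw [show s - 1 / 2 = (s - 1) + 1 / 2 by ring,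
    ENNReal.rpow_add_of_nonneg _ _ (by linarith) (by norm_num)]
  ring

lemma aux_tri (F : ℝ × ℝ × ℝ → ℝ≥0∞) (hF : Measurable F) :
    ∫⁻ v, F v = ∫⁻ p : ℝ × ℝ, ∫⁻ z, F (p.1, p.2, z) := by
  have hm : Measurable fun q : (ℝ × ℝ) × ℝ => F (q.1.1, q.1.2, q.2) := by fun_prop
  have hm' : Measurable fun p : ℝ × ℝ => ∫⁻ z, F (p.1, p.2, z) := hm.lintegral_prod_right'
  rw [Measure.volume_eq_prod, lintegral_prod _ hF.aemeasurable, Measure.volume_eq_prod,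
    lintegral_prod _ hm'.aemeasurable]
  refine lintegral_congr fun x => ?_
  rw [lintegral_prod _ (by fun_prop)]

lemma aux_pd_cont (f : ℝ × ℝ × ℝ → ℝ) (hf : ContDiff ℝ 1 f) (i : Fin 3) : Continuous (pd i f) :=
  (hf.continuous_fderiv one_ne_zero).clm_apply continuous_const

lemma aux_slice0 (f : ℝ × ℝ × ℝ → ℝ) (hf : ContDiff ℝ 1 f) (hc : HasCompactSupport f)
    (s : ℝ) (hs : 1 < s) (x y : ℝ) :
    (∫⁻ z, ‖f (x, y, z)‖ₑ ^ (2:ℝ)) ^ s ≤ ENNReal.ofReal (2 * s) *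
      ∫⁻ x, (∫⁻ z, ‖f (x, y, z)‖ₑ ^ (2:ℝ)) ^ (s - 1 / 2) *
        (∫⁻ z, ‖pd 0 f (x, y, z)‖ₑ ^ (2:ℝ)) ^ (1 / 2 : ℝ) := by
  have hL : ∀ v : ℝ × ℝ, HasFDerivAt (fun v : ℝ × ℝ => (v.1, y, v.2))
      ((ContinuousLinearMap.fst ℝ ℝ ℝ).prod
        ((0 : ℝ × ℝ →L[ℝ] ℝ).prod (ContinuousLinearMap.snd ℝ ℝ ℝ))) v := fun v =>
    hasFDerivAt_fst.prodMk ((hasFDerivAt_const y v).prodMk hasFDerivAt_snd)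
  have key := aux_key2 (fun v => f (v.1, y, v.2)) (hf.comp (by fun_prop))
    (HasCompactSupport.intro (hc.image (by fun_prop : Continuous fun v : ℝ × ℝ × ℝ => (v.1, v.2.2)))
      fun v hv => image_eq_zero_of_notMem_tsupport fun hm => hv ⟨_, hm, rfl⟩) s hs x
  have e : ∀ v : ℝ × ℝ, fderiv ℝ (fun v : ℝ × ℝ => f (v.1, y, v.2)) v (1, 0)
      = pd 0 f (v.1, y, v.2) := by
    intro v
    have := ((hf.differentiable one_ne_zero) (v.1, y, v.2)).hasFDerivAt.comp v (hL v)
    have h2 := this.fderiv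
    simp only [Function.comp_def] at h2
    rw [h2]
    simp [pd]
  simpa only [e] using key

lemma aux_slice1 (f : ℝ × ℝ × ℝ → ℝ) (hf : ContDiff ℝ 1 f) (hc : HasCompactSupport f)
    (s : ℝ) (hs : 1 < s) (x y : ℝ) :
    (∫⁻ z, ‖f (x, y, z)‖ₑ ^ (2:ℝ)) ^ s ≤ ENNReal.ofReal (2 * s) *
      ∫⁻ y, (∫⁻ z, ‖f (x, y, z)‖ₑ ^ (2:ℝ)) ^ (s - 1 / 2) *
        (∫⁻ z, ‖pd 1 f (x, y, z)‖ₑ ^ (2:ℝ)) ^ (1 / 2 : ℝ) := by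
  have hL : ∀ v : ℝ × ℝ, HasFDerivAt (fun v : ℝ × ℝ => (x, v.1, v.2))
      ((0 : ℝ × ℝ →L[ℝ] ℝ).prod ((ContinuousLinearMap.fst ℝ ℝ ℝ).prod
        (ContinuousLinearMap.snd ℝ ℝ ℝ))) v := fun v =>
    (hasFDerivAt_const x v).prodMk (hasFDerivAt_fst.prodMk hasFDerivAt_snd)
  have key := aux_key2 (fun v => f (x, v.1, v.2)) (hf.comp (by fun_prop))
    (HasCompactSupport.intro (hc.image (by fun_prop : Continuous fun v : ℝ × ℝ × ℝ => (v.2.1, v.2.2)))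
      fun v hv => image_eq_zero_of_notMem_tsupport fun hm => hv ⟨_, hm, rfl⟩) s hs y
  have e : ∀ v : ℝ × ℝ, fderiv ℝ (fun v : ℝ × ℝ => f (x, v.1, v.2)) v (1, 0)
      = pd 1 f (x, v.1, v.2) := by
    intro v
    have := ((hf.differentiable one_ne_zero) (x, v.1, v.2)).hasFDerivAt.comp v (hL v)
    have h2 := this.fderiv
    simp only [Function.comp_def] at h2
    rw [h2]
    simp [pd]
  simpa only [e] using key

lemma aux_slice2 (f : ℝ × ℝ × ℝ → ℝ) (hf : ContDiff ℝ 1 f) (hc : HasCompactSupport f)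
    (p : ℝ) (hp : 1 < p) (x y z : ℝ) :
    ‖f (x, y, z)‖ₑ ^ p ≤ ENNReal.ofReal p *
      ∫⁻ z, ‖f (x, y, z)‖ₑ ^ (p - 1) * ‖pd 2 f (x, y, z)‖ₑ := by
  have key := aux_one_d (fun z => f (x, y, z)) (hf.comp (by fun_prop))
    (HasCompactSupport.intro (hc.image (by fun_prop : Continuous fun v : ℝ × ℝ × ℝ => v.2.2))
      fun v hv => image_eq_zero_of_notMem_tsupport fun hm => hv ⟨_, hm, rfl⟩) p hp z
  have e : ∀ z : ℝ, deriv (fun z => f (x, y, z)) z = pd 2 f (x, y, z) := by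
    intro z
    have hL : HasDerivAt (fun z : ℝ => (x, y, z)) ((0:ℝ), (0:ℝ), (1:ℝ)) z :=
      (hasDerivAt_const z x).prodMk ((hasDerivAt_const z y).prodMk (hasDerivAt_id z))
    have := ((hf.differentiable one_ne_zero) (x, y, z)).hasFDerivAt.comp_hasDerivAt z hL
    have h2 := this.deriv
    simp only [Function.comp_def] at h2
    rw [h2]
    simp [pd]
  simpa only [e] using key

lemma aux_meas (F : ℝ × ℝ × ℝ → ℝ) (hF : Continuous F) :
    Measurable fun p : ℝ × ℝ => ∫⁻ z, ‖F (p.1, p.2, z)‖ₑ ^ (2:ℝ) := by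
  have hm : Measurable fun q : (ℝ × ℝ) × ℝ => ‖F (q.1.1, q.1.2, q.2)‖ₑ ^ (2:ℝ) :=
    (hF.comp (by fun_prop : Continuous fun q : (ℝ × ℝ) × ℝ =>
      (q.1.1, q.1.2, q.2))).measurable.enorm.pow_const _
  exact hm.lintegral_prod_right'

lemma aux_fin (f : ℝ × ℝ × ℝ → ℝ) (hf : Continuous f) (hc : HasCompactSupport f)
    (k : ℝ) (hk : 0 < k) :
    ∫⁻ p : ℝ × ℝ, (∫⁻ z, ‖f (p.1, p.2, z)‖ₑ ^ (2:ℝ)) ^ k ≠ ⊤ := by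
  obtain ⟨C, hC⟩ := hc.exists_bound_of_continuous hf
  set K1 : Set (ℝ × ℝ) := (fun v : ℝ × ℝ × ℝ => (v.1, v.2.1)) '' tsupport f with hK1
  set K3 : Set ℝ := (fun v : ℝ × ℝ × ℝ => v.2.2) '' tsupport f with hK3
  have c1 : IsCompact K1 := hc.image (by fun_prop)
  have c3 : IsCompact K3 := hc.image (by fun_prop)
  set M : ℝ≥0∞ := ENNReal.ofReal C ^ (2:ℝ) * volume K3 with hM
  have hMt : M ^ k ≠ ⊤ := by
    refine ENNReal.rpow_ne_top_of_nonneg hk.le (ENNReal.mul_ne_top ?_ c3.measure_lt_top.ne)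
    exact ENNReal.rpow_ne_top_of_nonneg (by norm_num) ENNReal.ofReal_ne_top
  have hle : ∀ p : ℝ × ℝ, (∫⁻ z, ‖f (p.1, p.2, z)‖ₑ ^ (2:ℝ)) ^ k ≤
      K1.indicator (fun _ => M ^ k) p := by
    intro p
    by_cases hp : p ∈ K1
    · rw [Set.indicator_of_mem hp]
      refine ENNReal.rpow_le_rpow ?_ hk.le
      rw [hM, ← lintegral_indicator_const c3.measurableSet]
      refine lintegral_mono fun z => ?_
      by_cases hz : z ∈ K3
      · rw [Set.indicator_of_mem hz]
        refine ENNReal.rpow_le_rpow ?_ (by norm_num)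
        rw [← ofReal_norm]
        exact ENNReal.ofReal_le_ofReal (hC _)
      · have : f (p.1, p.2, z) = 0 :=
          image_eq_zero_of_notMem_tsupport fun hm => hz ⟨_, hm, rfl⟩
        simp [this]
    · have : ∀ z, f (p.1, p.2, z) = 0 := fun z =>
          image_eq_zero_of_notMem_tsupport fun hm => hp ⟨_, hm, rfl⟩
      simp [this, hk]
  refine ((lintegral_mono hle).trans_lt ?_).ne
  rw [lintegral_indicator_const c1.measurableSet]
  exact ENNReal.mul_lt_top hMt.lt_top c1.measure_lt_top

lemma aux_GN (f : ℝ × ℝ × ℝ → ℝ) (hf : ContDiff ℝ 1 f) (hc : HasCompactSupport f)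
    (k : ℝ) (hk : 2 < k) :
    ∫⁻ p : ℝ × ℝ, (∫⁻ z, ‖f (p.1, p.2, z)‖ₑ ^ (2:ℝ)) ^ k ≤
      (ENNReal.ofReal k * ENNReal.ofReal k) ^ (k - 1) * (∫⁻ v, ‖f v‖ₑ ^ (2:ℝ)) *
      ((∫⁻ v, ‖pd 0 f v‖ₑ ^ (2:ℝ)) ^ (1/2 : ℝ) * (∫⁻ v, ‖pd 1 f v‖ₑ ^ (2:ℝ)) ^ (1/2 : ℝ)) ^ (k - 1) := by
  have hfin := aux_fin f hf.continuous hc k (by linarith)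
  have tri : ∀ F : ℝ × ℝ × ℝ → ℝ, Continuous F → ∫⁻ v, ‖F v‖ₑ ^ (2:ℝ) =
      ∫⁻ p : ℝ × ℝ, ∫⁻ z, ‖F (p.1, p.2, z)‖ₑ ^ (2:ℝ) := fun F hF =>
    aux_tri _ (hF.measurable.enorm.pow_const _)
  rw [tri _ hf.continuous, tri _ (aux_pd_cont f hf 0), tri _ (aux_pd_cont f hf 1)]
  have mA := aux_meas f hf.continuous
  have m0 := aux_meas _ (aux_pd_cont f hf 0)
  have m1 := aux_meas _ (aux_pd_cont f hf 1)
  have s0 := fun x y => aux_slice0 f hf hc (k/2) (by linarith) x y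
  have s1 := fun x y => aux_slice1 f hf hc (k/2) (by linarith) x y
  set A : ℝ × ℝ → ℝ≥0∞ := fun p => ∫⁻ z, ‖f (p.1, p.2, z)‖ₑ ^ (2:ℝ) with hA
  set D0 : ℝ × ℝ → ℝ≥0∞ := fun p => ∫⁻ z, ‖pd 0 f (p.1, p.2, z)‖ₑ ^ (2:ℝ) with hD0
  set D1 : ℝ × ℝ → ℝ≥0∞ := fun p => ∫⁻ z, ‖pd 1 f (p.1, p.2, z)‖ₑ ^ (2:ℝ) with hD1
  have s0' : ∀ x y, A (x, y) ^ (k/2) ≤ ENNReal.ofReal k *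
      ∫⁻ x, A (x, y) ^ (k/2 - 1/2) * D0 (x, y) ^ (1/2 : ℝ) := by
    intro x y
    have := s0 x y
    rwa [show 2 * (k/2) = k by ring] at this
  have s1' : ∀ x y, A (x, y) ^ (k/2) ≤ ENNReal.ofReal k *
      ∫⁻ y, A (x, y) ^ (k/2 - 1/2) * D1 (x, y) ^ (1/2 : ℝ) := by
    intro x y
    have := s1 x y
    rwa [show 2 * (k/2) = k by ring] at this
  clear s0 s1
  change ∫⁻ p, A p ^ k ≤ _ * (∫⁻ p, A p) * ((∫⁻ p, D0 p) ^ (1/2 : ℝ) * (∫⁻ p, D1 p) ^ (1/2 : ℝ)) ^ (k - 1)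
  change ∫⁻ p, A p ^ k ≠ ⊤ at hfin
  clear_value A D0 D1
  set I := ∫⁻ p, A p ^ k with hI
  set d := (∫⁻ p, D0 p) ^ (1/2 : ℝ) * (∫⁻ p, D1 p) ^ (1/2 : ℝ) with hd
  -- Hölder
  have holder : ∀ D : ℝ × ℝ → ℝ≥0∞, Measurable D →
      ∫⁻ p, A p ^ (k/2 - 1/2) * D p ^ (1/2 : ℝ) ≤
        (∫⁻ p, A p ^ (k - 1)) ^ (1/2 : ℝ) * (∫⁻ p, D p) ^ (1/2 : ℝ) := by
    intro D hD
    have := ENNReal.lintegral_mul_norm_pow_le (μ := volume) (mA.pow_const (k - 1)).aemeasurable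
      hD.aemeasurable (p := 1/2) (q := 1/2) (by norm_num) (by norm_num) (by norm_num)
    refine le_trans (le_of_eq ?_) this
    refine lintegral_congr fun p => ?_
    rw [← ENNReal.rpow_mul]
    congr 2; ring
  have mp0 : Measurable fun p : ℝ × ℝ => A p ^ (k/2 - 1/2) * D0 p ^ (1/2 : ℝ) := by fun_prop
  have mp1 : Measurable fun p : ℝ × ℝ => A p ^ (k/2 - 1/2) * D1 p ^ (1/2 : ℝ) := by fun_prop
  have step1 : I ≤ (ENNReal.ofReal k * ENNReal.ofReal k) * d * ∫⁻ p, A p ^ (k - 1) := by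
    calc I ≤ ∫⁻ p : ℝ × ℝ, (ENNReal.ofReal k * ∫⁻ y, A (p.1, y) ^ (k/2 - 1/2) * D1 (p.1, y) ^ (1/2 : ℝ)) *
          (ENNReal.ofReal k * ∫⁻ x, A (x, p.2) ^ (k/2 - 1/2) * D0 (x, p.2) ^ (1/2 : ℝ)) := by
          refine lintegral_mono fun p => ?_
          have : A p ^ k = A p ^ (k/2) * A p ^ (k/2) := by
            rw [← ENNReal.rpow_add_of_nonneg _ _ (by linarith) (by linarith)]; congr 1; ring
          rw [this]
          exact mul_le_mul' (s1' p.1 p.2) (s0' p.1 p.2)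
      _ = (ENNReal.ofReal k * ∫⁻ p, A p ^ (k/2 - 1/2) * D1 p ^ (1/2 : ℝ)) *
          (ENNReal.ofReal k * ∫⁻ p, A p ^ (k/2 - 1/2) * D0 p ^ (1/2 : ℝ)) := by
          rw [Measure.volume_eq_prod, lintegral_prod_mul
            (f := fun x => ENNReal.ofReal k * ∫⁻ y, A (x, y) ^ (k/2 - 1/2) * D1 (x, y) ^ (1/2 : ℝ))
            (g := fun y => ENNReal.ofReal k * ∫⁻ x, A (x, y) ^ (k/2 - 1/2) * D0 (x, y) ^ (1/2 : ℝ)),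
            lintegral_const_mul' _ _ ENNReal.ofReal_ne_top,
            lintegral_const_mul' _ _ ENNReal.ofReal_ne_top,
            lintegral_prod _ mp1.aemeasurable, lintegral_prod_symm _ mp0.aemeasurable]
          · exact (mp1.lintegral_prod_right'.const_mul _).aemeasurable
          · exact (mp0.lintegral_prod_left'.const_mul _).aemeasurable
      _ ≤ (ENNReal.ofReal k * ((∫⁻ p, A p ^ (k - 1)) ^ (1/2 : ℝ) * (∫⁻ p, D1 p) ^ (1/2 : ℝ))) *
          (ENNReal.ofReal k * ((∫⁻ p, A p ^ (k - 1)) ^ (1/2 : ℝ) * (∫⁻ p, D0 p) ^ (1/2 : ℝ))) := by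
          gcongr
          · exact holder D1 m1
          · exact holder D0 m0
      _ = (ENNReal.ofReal k * ENNReal.ofReal k) * d *
          ((∫⁻ p, A p ^ (k - 1)) ^ (1/2 : ℝ) * (∫⁻ p, A p ^ (k - 1)) ^ (1/2 : ℝ)) := by
          rw [hd]; ring
      _ = _ := by
          rw [← ENNReal.rpow_add_of_nonneg _ _ (by norm_num) (by norm_num)]; norm_num
  have hk1 : 0 < k - 1 := by linarith
  have interp : ∫⁻ p, A p ^ (k - 1) ≤ (∫⁻ p, A p) ^ (1 / (k-1)) * I ^ ((k-2)/(k-1)) := by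
    have := ENNReal.lintegral_mul_norm_pow_le (μ := volume) mA.aemeasurable
      (mA.pow_const k).aemeasurable (p := 1/(k-1)) (q := (k-2)/(k-1)) (by positivity)
      (div_nonneg (by linarith) hk1.le) (by field_simp; ring)
    refine le_trans (le_of_eq ?_) this
    refine lintegral_congr fun p => ?_
    rw [← ENNReal.rpow_mul, ← ENNReal.rpow_add_of_nonneg _ _ (by positivity)
      (mul_nonneg (by linarith) (div_nonneg (by linarith) hk1.le))]
    congr 1; field_simp; ring
  by_cases hI0 : I = 0
  · rw [hI0]; exact zero_le
  have step2 : I ^ (1/(k-1)) ≤ (ENNReal.ofReal k * ENNReal.ofReal k) * d * (∫⁻ p, A p) ^ (1 / (k-1)) := by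
    have hne : I ^ ((k-2)/(k-1)) ≠ 0 := by
      simp [ENNReal.rpow_eq_zero_iff, hI0, hfin]
    have hnt : I ^ ((k-2)/(k-1)) ≠ ⊤ :=
      ENNReal.rpow_ne_top_of_nonneg (div_nonneg (by linarith) hk1.le) hfin
    rw [← ENNReal.mul_le_mul_iff_left hne hnt, ← ENNReal.rpow_add _ _ hI0 hfin,
      show 1/(k-1) + (k-2)/(k-1) = 1 by field_simp; ring, ENNReal.rpow_one, mul_assoc]
    exact step1.trans (by gcongr)
  have step3 := ENNReal.rpow_le_rpow step2 hk1.le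
  rw [← ENNReal.rpow_mul, one_div_mul_cancel hk1.ne', ENNReal.rpow_one,
    ENNReal.mul_rpow_of_nonneg _ _ hk1.le, ENNReal.mul_rpow_of_nonneg _ _ hk1.le, ← ENNReal.rpow_mul,
    one_div_mul_cancel hk1.ne', ENNReal.rpow_one] at step3
  refine step3.trans (le_of_eq ?_)
  ring

theorem stmt1 (r : ℝ) (hr2 : 2 < r) (hr3 : r < 3) :
    ∃ C : ℝ≥0∞, C ≠ ⊤ ∧ ∀ φ f g : ℝ × ℝ × ℝ → ℝ,
      ContDiff ℝ (⊤ : ℕ∞) φ → HasCompactSupport φ →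
      ContDiff ℝ (⊤ : ℕ∞) f → HasCompactSupport f →
      ContDiff ℝ (⊤ : ℕ∞) g → HasCompactSupport g →
      ENNReal.ofReal |∫ x, φ x * f x * g x| ≤
        C * eLpNorm φ 2 volume ^ ((r - 1) / r)
          * eLpNorm (pd 2 φ) (ENNReal.ofReal (2 / (3 - r))) volume ^ (1 / r)
          * eLpNorm f 2 volume ^ ((r - 2) / r)
          * eLpNorm (pd 0 f) 2 volume ^ (1 / r)
          * eLpNorm (pd 1 f) 2 volume ^ (1 / r)
          * eLpNorm g 2 volume := by
  have hr0 : 0 < r := by linarith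
  have hr2' : 0 < r - 2 := by linarith
  have hr3' : 0 < 3 - r := by linarith
  set k : ℝ := r / (r - 2) with hkdef
  have hk : 2 < k := by rw [hkdef, lt_div_iff₀ hr2']; linarith
  have hk0 : 0 < k := by linarith
  set K : ℝ≥0∞ := (ENNReal.ofReal k * ENNReal.ofReal k) ^ (k - 1) with hK
  have hKt : K ≠ ⊤ := ENNReal.rpow_ne_top_of_nonneg (by linarith)
    (ENNReal.mul_ne_top ENNReal.ofReal_ne_top ENNReal.ofReal_ne_top)
  refine ⟨ENNReal.ofReal r ^ (1/r) * K ^ (1/(2*k)), ENNReal.mul_ne_top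
    (ENNReal.rpow_ne_top_of_nonneg (by positivity) ENNReal.ofReal_ne_top)
    (ENNReal.rpow_ne_top_of_nonneg (by positivity) hKt), ?_⟩
  intro φ f g hφ hφc hf hfc hg hgc
  have hφ1 : ContDiff ℝ 1 φ := hφ.of_le (by norm_cast)
  have hf1 : ContDiff ℝ 1 f := hf.of_le (by norm_cast)
  have hg1 := hg.continuous
  have e2 : ∀ F : ℝ × ℝ × ℝ → ℝ, eLpNorm F 2 volume = (∫⁻ v, ‖F v‖ₑ ^ (2:ℝ)) ^ (1/2 : ℝ) := by
    intro F
    rw [eLpNorm_eq_lintegral_rpow_enorm_toReal two_ne_zero ENNReal.ofNat_ne_top]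
    simp
  have hm0 : 0 < 2 / (3 - r) := by positivity
  have em : ∀ F : ℝ × ℝ × ℝ → ℝ, eLpNorm F (ENNReal.ofReal (2 / (3 - r))) volume =
      (∫⁻ v, ‖F v‖ₑ ^ (2 / (3 - r))) ^ ((3 - r) / 2) := by
    intro F
    rw [eLpNorm_eq_lintegral_rpow_enorm_toReal (by simpa using hm0) ENNReal.ofReal_ne_top,
      ENNReal.toReal_ofReal hm0.le, one_div_div]
  rw [e2, e2, e2, e2, e2, em]
  have GN := aux_GN f hf1 hfc k hk
  rw [← hK] at GN
  clear_value K
  have cφ := hφ1.continuous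
  have cf := hf1.continuous
  have cd := aux_pd_cont φ hφ1 2
  have mP : Measurable fun p : ℝ × ℝ => ∫⁻ z, ‖φ (p.1, p.2, z)‖ₑ ^ (r - 1) * ‖pd 2 φ (p.1, p.2, z)‖ₑ := by
    have hm : Measurable fun q : (ℝ × ℝ) × ℝ =>
        ‖φ (q.1.1, q.1.2, q.2)‖ₑ ^ (r - 1) * ‖pd 2 φ (q.1.1, q.1.2, q.2)‖ₑ := by
      have c : Continuous fun q : (ℝ × ℝ) × ℝ => (q.1.1, q.1.2, q.2) := by fun_prop
      exact ((cφ.comp c).measurable.enorm.pow_const _).mul (cd.comp c).measurable.enorm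
    exact hm.lintegral_prod_right'
  have mA := aux_meas f cf
  have mB := aux_meas g hg1
  have hPint : ∫⁻ p : ℝ × ℝ, ENNReal.ofReal r *
      ∫⁻ z, ‖φ (p.1, p.2, z)‖ₑ ^ (r - 1) * ‖pd 2 φ (p.1, p.2, z)‖ₑ ≤
      ENNReal.ofReal r * ((∫⁻ v, ‖φ v‖ₑ ^ (2:ℝ)) ^ ((r-1)/2) *
        (∫⁻ v, ‖pd 2 φ v‖ₑ ^ (2 / (3 - r))) ^ ((3 - r) / 2)) := by
    rw [lintegral_const_mul' _ _ ENNReal.ofReal_ne_top, ← aux_tri (fun v => ‖φ v‖ₑ ^ (r - 1) * ‖pd 2 φ v‖ₑ)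
      ((cφ.measurable.enorm.pow_const _).mul cd.measurable.enorm)]
    gcongr
    have := ENNReal.lintegral_mul_norm_pow_le (μ := volume)
      (cφ.measurable.enorm.pow_const (2:ℝ)).aemeasurable
      (cd.measurable.enorm.pow_const (2 / (3 - r))).aemeasurable
      (p := (r-1)/2) (q := (3 - r)/2) (by linarith) (by linarith) (by ring)
    refine le_trans (le_of_eq ?_) this
    refine lintegral_congr fun v => ?_
    rw [← ENNReal.rpow_mul, ← ENNReal.rpow_mul, show 2 / (3 - r) * ((3 - r)/2) = 1 by field_simp,
      ENNReal.rpow_one]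
    congr 2; ring
  have hBint : ∫⁻ p : ℝ × ℝ, ∫⁻ z, ‖g (p.1, p.2, z)‖ₑ ^ (2:ℝ) = ∫⁻ v, ‖g v‖ₑ ^ (2:ℝ) :=
    (aux_tri _ (hg1.measurable.enorm.pow_const _)).symm
  have sl := fun x y z => aux_slice2 φ hφ1 hφc r (by linarith) x y z
  have mP' : Measurable fun p : ℝ × ℝ => ENNReal.ofReal r *
      ∫⁻ z, ‖φ (p.1, p.2, z)‖ₑ ^ (r - 1) * ‖pd 2 φ (p.1, p.2, z)‖ₑ := mP.const_mul _
  set P : ℝ × ℝ → ℝ≥0∞ := fun p => ENNReal.ofReal r *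
      ∫⁻ z, ‖φ (p.1, p.2, z)‖ₑ ^ (r - 1) * ‖pd 2 φ (p.1, p.2, z)‖ₑ with hP
  set A : ℝ × ℝ → ℝ≥0∞ := fun p => ∫⁻ z, ‖f (p.1, p.2, z)‖ₑ ^ (2:ℝ) with hA
  set B : ℝ × ℝ → ℝ≥0∞ := fun p => ∫⁻ z, ‖g (p.1, p.2, z)‖ₑ ^ (2:ℝ) with hB
  have main : ENNReal.ofReal |∫ x, φ x * f x * g x| ≤
      (∫⁻ p, P p) ^ (1/r) * (∫⁻ p, A p ^ k) ^ (1/(2*k)) * (∫⁻ p, B p) ^ (1/2 : ℝ) := by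
    calc ENNReal.ofReal |∫ x, φ x * f x * g x| = ‖∫ x, φ x * f x * g x‖ₑ := by
          rw [← ofReal_norm, Real.norm_eq_abs]
      _ ≤ ∫⁻ x, ‖φ x * f x * g x‖ₑ := enorm_integral_le_lintegral_enorm _
      _ = ∫⁻ p : ℝ × ℝ, ∫⁻ z, ‖φ (p.1, p.2, z) * f (p.1, p.2, z) * g (p.1, p.2, z)‖ₑ :=
          aux_tri _ ((cφ.mul cf).mul hg1).measurable.enorm
      _ ≤ ∫⁻ p : ℝ × ℝ, (P p ^ (2/r) * (A p ^ k) ^ (1/k)) ^ (1/2 : ℝ) * B p ^ (1/2 : ℝ) := by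
          refine lintegral_mono fun p => ?_
          have c : Continuous fun z : ℝ => (p.1, p.2, z) := by fun_prop
          have h1 : ∀ z, ‖φ (p.1, p.2, z) * f (p.1, p.2, z) * g (p.1, p.2, z)‖ₑ ≤
              P p ^ (1/r) * ((‖f (p.1, p.2, z)‖ₑ ^ (2:ℝ)) ^ (1/2 : ℝ) *
                (‖g (p.1, p.2, z)‖ₑ ^ (2:ℝ)) ^ (1/2 : ℝ)) := by
            intro z
            rw [← ENNReal.rpow_mul, ← ENNReal.rpow_mul, enorm_mul, enorm_mul, mul_assoc]
            norm_num only [ENNReal.rpow_one]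
            gcongr
            have := ENNReal.rpow_le_rpow (sl p.1 p.2 z) (by positivity : 0 ≤ 1 / r)
            rwa [← ENNReal.rpow_mul, mul_one_div_cancel hr0.ne', ENNReal.rpow_one] at this
          refine (lintegral_mono h1).trans ?_
          rw [lintegral_const_mul _ (by
            exact (((cf.comp c).measurable.enorm.pow_const _).pow_const _).mul
              (((hg1.comp c).measurable.enorm.pow_const _).pow_const _))]
          rw [← ENNReal.rpow_mul, mul_one_div_cancel hk0.ne', ENNReal.rpow_one,
            ENNReal.mul_rpow_of_nonneg (P p ^ (2/r)) (A p) (by norm_num), ← ENNReal.rpow_mul (P p),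
            show 2 / r * (1/2) = 1/r by ring, mul_assoc]
          gcongr
          exact ENNReal.lintegral_mul_norm_pow_le
            ((cf.comp c).measurable.enorm.pow_const _).aemeasurable
            ((hg1.comp c).measurable.enorm.pow_const _).aemeasurable
            (by norm_num) (by norm_num) (by norm_num)
      _ ≤ (∫⁻ p, P p ^ (2/r) * (A p ^ k) ^ (1/k)) ^ (1/2 : ℝ) * (∫⁻ p, B p) ^ (1/2 : ℝ) :=
          ENNReal.lintegral_mul_norm_pow_le (by fun_prop) mB.aemeasurable
            (by norm_num) (by norm_num) (by norm_num)
      _ ≤ ((∫⁻ p, P p) ^ (2/r) * (∫⁻ p, A p ^ k) ^ (1/k)) ^ (1/2 : ℝ) * (∫⁻ p, B p) ^ (1/2 : ℝ) := by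
          gcongr
          exact ENNReal.lintegral_mul_norm_pow_le mP'.aemeasurable (mA.pow_const _).aemeasurable
            (by positivity) (by positivity) (by rw [hkdef]; field_simp; ring)
      _ = _ := by
          rw [ENNReal.mul_rpow_of_nonneg _ _ (by norm_num), ← ENNReal.rpow_mul, ← ENNReal.rpow_mul]
          congr 3
          · ring
          · field_simp
  refine main.trans ?_
  rw [hBint]
  have hA1 := ENNReal.rpow_le_rpow GN (by positivity : 0 ≤ 1/(2*k))
  have hP1 := ENNReal.rpow_le_rpow hPint (by positivity : 0 ≤ 1/r)
  refine (mul_le_mul_left (mul_le_mul' hP1 hA1) _).trans (le_of_eq ?_)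
  have hk2 : (0:ℝ) ≤ 1/(2*k) := by positivity
  have hir : (0:ℝ) ≤ 1/r := by positivity
  have hk1 : (0:ℝ) ≤ k - 1 := by linarith
  have E1 : 1/(2*k) = 1/2 * ((r-2)/r) := by rw [hkdef]; field_simp
  have E2 : (k-1) * (1/(2*k)) = 1/r := by rw [hkdef]; field_simp; ring
  simp only [ENNReal.mul_rpow_of_nonneg _ _ hk2, ENNReal.mul_rpow_of_nonneg _ _ hir]
  rw [← ENNReal.rpow_mul _ (k-1) (1/(2*k)), E2, ENNReal.mul_rpow_of_nonneg _ _ hir]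
  rw [← ENNReal.rpow_mul _ ((r-1)/2) (1/r), ← ENNReal.rpow_mul _ (1/2) ((r-1)/r),
    ← ENNReal.rpow_mul _ (1/2) ((r-2)/r), ← E1, show (r-1)/2 * (1/r) = 1/2 * ((r-1)/r) by ring]
  ring
end
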